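/- In S = ℚ[t_1, t_2, t_3], the ideal I = (t_1^2 - t_2 t_3, t_2^2 - t_3^2) has height 2, satisfies V(I, t_i) = {0} for i = 1, 2, 3, and is a lattice ideal (equivalently, each t_i is a non-zerodivisor on S/I). -/

import Mathlib

open MvPolynomial

noncomputable section

/-- View a function `Fin s → ℕ` as a finitely supported function (an exponent vector). -/
abbrev toFs {s : ℕ} (a : Fin s → ℕ) : Fin s →₀ ℕ := Finsupp.equivFunOnFinite.symm a

/-- The coercion of an exponent vector to `ℤ`. -/
abbrev intVec {s : ℕ} (a : Fin s → ℕ) : Fin s → ℤ := fun i => (a i : ℤ)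

/-- The lattice ideal `I(𝓛)` of a lattice `𝓛 ⊆ ℤ^s`, generated by the binomials
`t^{a⁺} - t^{a⁻}` for `a ∈ 𝓛`. -/
def latticeIdeal {s : ℕ} (K : Type*) [Field K] (𝓛 : AddSubgroup (Fin s → ℤ)) :
    Ideal (MvPolynomial (Fin s) K) :=
  Ideal.span {f | ∃ a ∈ 𝓛,
    f = monomial (toFs fun i => (a i).toNat) (1 : K) - monomial (toFs fun i => (-a i).toNat) 1}

/-- A binomial `t^a - t^b`. -/
def IsBinomial {s : ℕ} {K : Type*} [Field K] (f : MvPolynomial (Fin s) K) : Prop :=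
  ∃ a b : Fin s → ℕ, f = monomial (toFs a) (1 : K) - monomial (toFs b) 1

/-- The affine zero set `V(I) ⊆ 𝔸_K^s` of an ideal of `K[t_1, …, t_s]`. -/
def zeroSet {s : ℕ} {K : Type*} [Field K] (I : Ideal (MvPolynomial (Fin s) K)) :
    Set (Fin s → K) := {x | ∀ f ∈ I, eval x f = 0}

/-- The height of an ideal: the infimum of the heights of the primes containing it. -/
def idealHeight {R : Type*} [CommRing R] (I : Ideal R) : ℕ∞ :=
  ⨅ p ∈ {p : PrimeSpectrum R | I ≤ p.asIdeal}, Order.height p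

/-- The ideal of the example. -/
def exIdeal : Ideal (MvPolynomial (Fin 3) ℚ) :=
  Ideal.span {X 0 ^ 2 - X 1 * X 2, X 1 ^ 2 - X 2 ^ 2}

lemma ex_g1 : (X 0 ^ 2 - X 1 * X 2 : MvPolynomial (Fin 3) ℚ) ∈ exIdeal :=
  Ideal.subset_span (by simp)

lemma ex_g2 : (X 1 ^ 2 - X 2 ^ 2 : MvPolynomial (Fin 3) ℚ) ∈ exIdeal :=
  Ideal.subset_span (by simp)

/-- A substitution changes a polynomial only by an element of any ideal containing
the differences `t_i - g_i`. -/
lemma sub_aeval_mem (g : Fin 3 → MvPolynomial (Fin 3) ℚ) (J : Ideal (MvPolynomial (Fin 3) ℚ))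
    (h : ∀ i, X i - g i ∈ J) (f : MvPolynomial (Fin 3) ℚ) : f - aeval g f ∈ J := by
  have : (Ideal.Quotient.mkₐ ℚ J) = (Ideal.Quotient.mkₐ ℚ J).comp (aeval g) := by
    apply MvPolynomial.algHom_ext
    intro i
    simp only [AlgHom.comp_apply, aeval_X, Ideal.Quotient.mkₐ_eq_mk]
    exact Ideal.Quotient.eq.2 (h i)
  exact Ideal.Quotient.eq.1 (DFunLike.congr_fun this f)

lemma X0_prime : Prime (X 0 : MvPolynomial (Fin 3) ℚ) := by
  let g : Fin 3 → MvPolynomial (Fin 3) ℚ := ![0, X 1, X 2]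
  have hg : ∀ i, X i - g i ∈ Ideal.span {(X 0 : MvPolynomial (Fin 3) ℚ)} := by
    intro i
    fin_cases i <;> simp [g]
  have key : ∀ f : MvPolynomial (Fin 3) ℚ, aeval g f = 0 → X 0 ∣ f := by
    intro f hf
    have h := Ideal.mem_span_singleton.1 (sub_aeval_mem g _ hg f)
    rwa [hf, sub_zero] at h
  have h0 : aeval g (X 0 : MvPolynomial (Fin 3) ℚ) = 0 := by rw [aeval_X]; rfl
  refine ⟨MvPolynomial.X_ne_zero 0, ?_, ?_⟩
  · intro h
    have := h.map (aeval g)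
    rw [h0] at this
    exact not_isUnit_zero this
  · rintro a b ⟨c, hc⟩
    have h := congrArg (aeval g) hc
    rw [map_mul, map_mul, h0, zero_mul] at h
    exact (mul_eq_zero.1 h).imp (key a) (key b)

lemma z_nzd (f : MvPolynomial (Fin 3) ℚ) (hf : X 2 * f ∈ exIdeal) : f ∈ exIdeal := by
  obtain ⟨a, b, hab⟩ := Ideal.mem_span_pair.1 hf
  let g : Fin 3 → MvPolynomial (Fin 3) ℚ := ![X 0, X 1, 0]
  have hg : ∀ i, X i - g i ∈ Ideal.span {(X 2 : MvPolynomial (Fin 3) ℚ)} := by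
    intro i
    fin_cases i <;> simp [g]
  obtain ⟨a', ha⟩ := Ideal.mem_span_singleton.1 (sub_aeval_mem g _ hg a)
  obtain ⟨b', hb⟩ := Ideal.mem_span_singleton.1 (sub_aeval_mem g _ hg b)
  have h0 := congrArg (aeval g) hab
  simp [g] at h0
  change aeval g a * X 0 ^ 2 + aeval g b * X 1 ^ 2 = 0 at h0
  set A := aeval g a
  set B := aeval g b
  have hx : ¬ (X 0 : MvPolynomial (Fin 3) ℚ) ∣ X 1 ^ 2 := by
    intro h
    have := X0_prime.dvd_of_dvd_pow h
    rw [MvPolynomial.X_dvd_X] at this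
    simp at this
  have hd : (X 0 : MvPolynomial (Fin 3) ℚ) ^ 2 ∣ B * X 1 ^ 2 := ⟨-A, by linear_combination h0⟩
  obtain ⟨c, hc⟩ := X0_prime.pow_dvd_of_dvd_mul_right 2 hx hd
  have hA : A = - c * X 1 ^ 2 := by
    have : (X 0 : MvPolynomial (Fin 3) ℚ) ^ 2 ≠ 0 := pow_ne_zero _ X0_prime.ne_zero
    apply mul_left_cancel₀ this
    linear_combination h0 - X 1 ^ 2 * hc
  have : f = (a' - c * X 2) * (X 0 ^ 2 - X 1 * X 2) + (b' + c * X 1) * (X 1 ^ 2 - X 2 ^ 2) := by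
    apply mul_left_cancel₀ (MvPolynomial.X_ne_zero (2 : Fin 3) : (X 2 : MvPolynomial (Fin 3) ℚ) ≠ 0)
    linear_combination -hab + (X 0 ^ 2 - X 1 * X 2) * (ha + hA) + (X 1 ^ 2 - X 2 ^ 2) * (hb + hc)
  rw [this]
  exact add_mem (Ideal.mul_mem_left _ _ ex_g1) (Ideal.mul_mem_left _ _ ex_g2)

lemma X_nzd (i : Fin 3) (f : MvPolynomial (Fin 3) ℚ) (hf : X i * f ∈ exIdeal) : f ∈ exIdeal := by
  fin_cases i
  · apply z_nzd; apply z_nzd; apply z_nzd; apply z_nzd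
    have e : (X 2 * (X 2 * (X 2 * (X 2 * f))) : MvPolynomial (Fin 3) ℚ) =
        X 0 ^ 3 * (X 0 * f) - (X 0 ^ 2 + X 1 * X 2) * f * (X 0 ^ 2 - X 1 * X 2)
          - X 2 ^ 2 * f * (X 1 ^ 2 - X 2 ^ 2) := by ring
    rw [e]
    exact sub_mem (sub_mem (Ideal.mul_mem_left _ _ hf) (Ideal.mul_mem_left _ _ ex_g1))
      (Ideal.mul_mem_left _ _ ex_g2)
  · apply z_nzd; apply z_nzd
    have e : (X 2 * (X 2 * f) : MvPolynomial (Fin 3) ℚ) =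
        X 1 * (X 1 * f) - f * (X 1 ^ 2 - X 2 ^ 2) := by ring
    rw [e]
    exact sub_mem (Ideal.mul_mem_left _ _ hf) (Ideal.mul_mem_left _ _ ex_g2)
  · exact z_nzd f hf

lemma X_pow_nzd (i : Fin 3) (n : ℕ) (f : MvPolynomial (Fin 3) ℚ) (hf : X i ^ n * f ∈ exIdeal) :
    f ∈ exIdeal := by
  induction n with
  | zero => simpa using hf
  | succ n ih => exact ih (X_nzd i _ (by rw [← mul_assoc, ← pow_succ']; exact hf))

/-- The monomial with exponents given by a function. -/
def mon (u : Fin 3 → ℕ) : MvPolynomial (Fin 3) ℚ := monomial (toFs u) 1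

lemma mon_eq (u : Fin 3 → ℕ) : mon u = X 0 ^ u 0 * X 1 ^ u 1 * X 2 ^ u 2 := by
  rw [mon, MvPolynomial.monomial_eq, Finsupp.prod_fintype _ _ (by simp)]
  simp [Fin.prod_univ_three]

lemma mon_add (u v : Fin 3 → ℕ) : mon (u + v) = mon u * mon v := by
  simp only [mon_eq, Pi.add_apply, pow_add]; ring

lemma mon_nzd (u : Fin 3 → ℕ) (f : MvPolynomial (Fin 3) ℚ) (hf : mon u * f ∈ exIdeal) :
    f ∈ exIdeal := by
  rw [mon_eq, mul_assoc, mul_assoc] at hf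
  exact X_pow_nzd _ _ _ (X_pow_nzd _ _ _ (X_pow_nzd _ _ _ hf))

/-- The lattice of the ideal. -/
def exLattice : AddSubgroup (Fin 3 → ℤ) where
  carrier := {a | ∀ u v : Fin 3 → ℕ, (∀ i, (u i : ℤ) - v i = a i) → mon u - mon v ∈ exIdeal}
  zero_mem' := by
    intro u v h
    have : u = v := by
      funext i
      have := h i
      simp only [Pi.zero_apply] at this
      omega
    simp [this]
  neg_mem' := by
    intro a ha u v h
    have := ha v u (fun i => by have := h i; simp only [Pi.neg_apply] at this; omega)
    rw [← neg_sub]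
    exact neg_mem this
  add_mem' := by
    intro a b ha hb u v h
    apply mon_nzd (fun i => (b i).natAbs)
    have h1 := ha (u + fun i => (b i).natAbs) (fun i => ((v i : ℤ) + b i + (b i).natAbs).toNat)
      (fun i => by have := h i; simp only [Pi.add_apply] at this ⊢; omega)
    have h2 := hb (fun i => ((v i : ℤ) + b i + (b i).natAbs).toNat) (v + fun i => (b i).natAbs)
      (fun i => by have := h i; simp only [Pi.add_apply] at this ⊢; omega)
    have h3 := add_mem h1 h2
    rw [sub_add_sub_cancel, mon_add, mon_add, ← sub_mul, mul_comm] at h3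
    exact h3

lemma exIdeal_eq : exIdeal = latticeIdeal ℚ exLattice := by
  apply le_antisymm
  · apply Ideal.span_le.2
    rintro f (rfl | rfl)
    · apply Ideal.subset_span
      refine ⟨![2, -1, -1], ?_, ?_⟩
      · intro u v h
        have h0 := h 0
        have h1 := h 1
        have h2 := h 2
        simp at h0 h1 h2
        have e0 : u 0 = v 0 + 2 := by omega
        have e1 : v 1 = u 1 + 1 := by omega
        have e2 : v 2 = u 2 + 1 := by omega
        have e : mon u - mon v = X 0 ^ v 0 * X 1 ^ u 1 * X 2 ^ u 2 * (X 0 ^ 2 - X 1 * X 2) := by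
          rw [mon_eq, mon_eq, e0, e1, e2]; ring
        rw [e]
        exact Ideal.mul_mem_left _ _ ex_g1
      · change _ = mon _ - mon _
        simp [mon_eq]
    · apply Ideal.subset_span
      refine ⟨![0, 2, -2], ?_, ?_⟩
      · intro u v h
        have h0 := h 0
        have h1 := h 1
        have h2 := h 2
        simp at h0 h1 h2
        have e0 : u 0 = v 0 := by omega
        have e1 : u 1 = v 1 + 2 := by omega
        have e2 : v 2 = u 2 + 2 := by omega
        have e : mon u - mon v = X 0 ^ v 0 * X 1 ^ v 1 * X 2 ^ u 2 * (X 1 ^ 2 - X 2 ^ 2) := by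
          rw [mon_eq, mon_eq, e0, e1, e2]; ring
        rw [e]
        exact Ideal.mul_mem_left _ _ ex_g2
      · change _ = mon _ - mon _
        simp [mon_eq]
  · apply Ideal.span_le.2
    rintro f ⟨a, ha, rfl⟩
    exact ha _ _ (fun i => by omega)

lemma zeroSet_ex (i : Fin 3) : zeroSet (exIdeal ⊔ Ideal.span {X i}) = {0} := by
  ext x
  simp only [Set.mem_singleton_iff]
  constructor
  · intro h
    have h1 := h _ (Ideal.mem_sup_left ex_g1)
    have h2 := h _ (Ideal.mem_sup_left ex_g2)
    have h3 := h _ (Ideal.mem_sup_right (Ideal.mem_span_singleton_self _))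
    simp at h1 h2 h3
    have key : x 2 = 0 := by
      fin_cases i
      · simp at h3
        have : x 2 ^ 4 = 0 := by
          rw [h3] at h1
          linear_combination -x 2 ^ 2 * h2 - x 1 * x 2 * h1
        exact pow_eq_zero_iff (by norm_num) |>.1 this
      · simp at h3
        have : x 2 ^ 2 = 0 := by rw [h3] at h2; linear_combination -h2
        exact pow_eq_zero_iff (by norm_num) |>.1 this
      · exact h3
    have k1 : x 1 = 0 := by simpa [key] using h2
    have k0 : x 0 = 0 := by simpa [key] using h1
    funext j
    fin_cases j <;> assumption
  · rintro rfl f hf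
    have : exIdeal ⊔ Ideal.span {X i} ≤ RingHom.ker (eval (0 : Fin 3 → ℚ)) := by
      refine sup_le (Ideal.span_le.2 ?_) (Ideal.span_le.2 ?_)
      · rintro f (rfl | rfl) <;> simp [RingHom.mem_ker]
      · rintro f rfl
        simp [RingHom.mem_ker]
    exact this hf

lemma ex_ne_top : exIdeal ≠ ⊤ := by
  intro h
  have h1 : (1 : MvPolynomial (Fin 3) ℚ) ∈ exIdeal ⊔ Ideal.span {X 0} := by simp [h]
  have h0 : (0 : Fin 3 → ℚ) ∈ zeroSet (exIdeal ⊔ Ideal.span {X 0}) := by simp [zeroSet_ex]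
  simpa using h0 _ h1

/-- A prime containing `t_2 - ε t_3` and the ideal has height at least two. -/
lemma two_le_height (p : PrimeSpectrum (MvPolynomial (Fin 3) ℚ)) (hp : exIdeal ≤ p.asIdeal)
    (ε : ℚ) (h : X 1 - C ε * X 2 ∈ p.asIdeal) : 2 ≤ Order.height p := by
  let g : Fin 3 → MvPolynomial (Fin 3) ℚ := ![X 0, C ε * X 2, X 2]
  let q : Ideal (MvPolynomial (Fin 3) ℚ) := RingHom.ker (aeval g : _ →ₐ[ℚ] MvPolynomial (Fin 3) ℚ)
  have hq : q.IsPrime := RingHom.ker_isPrime _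
  have hqp : q < p.asIdeal := by
    refine lt_of_le_of_ne ?_ ?_
    · intro f hf
      have h1 := sub_aeval_mem g p.asIdeal (by
        intro i
        fin_cases i
        · simp [g]
        · simpa [g] using h
        · simp [g]) f
      have h2 : aeval g f = 0 := hf
      rwa [h2, sub_zero] at h1
    · intro e
      have h1 := hp ex_g1
      rw [← e] at h1
      have h2 : aeval g (X 0 ^ 2 - X 1 * X 2 : MvPolynomial (Fin 3) ℚ) = 0 := h1
      have h3 := congrArg (eval (![1, 0, 0] : Fin 3 → ℚ)) h2
      simp [g] at h3
  have hbq : (⊥ : Ideal (MvPolynomial (Fin 3) ℚ)) < q := by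
    refine bot_lt_iff_ne_bot.2 ?_
    intro e
    have h1 : X 1 - C ε * X 2 ∈ q := by
      change aeval g _ = 0
      simp [g]
    rw [e, Ideal.mem_bot] at h1
    have h3 := congrArg (eval (![0, 1, 0] : Fin 3 → ℚ)) h1
    simp at h3
  have hpp := p.2
  have hb : (⊥ : Ideal (MvPolynomial (Fin 3) ℚ)).IsPrime := Ideal.isPrime_bot
  have l1 := Ideal.height_add_one_le_of_lt_of_isPrime hbq
  have l2 := Ideal.height_add_one_le_of_lt_of_isPrime hqp
  rw [← PrimeSpectrum.height_eq_orderHeight]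
  calc (2 : ℕ∞) = 0 + 1 + 1 := by norm_num
    _ ≤ (⊥ : Ideal (MvPolynomial (Fin 3) ℚ)).height + 1 + 1 := by gcongr; exact bot_le
    _ ≤ q.height + 1 := by gcongr
    _ ≤ _ := l2

lemma height_ex : idealHeight exIdeal = 2 := by
  apply le_antisymm
  · obtain ⟨p, hp⟩ := Ideal.nonempty_minimalPrimes ex_ne_top
    have h1 := Ideal.height_le_card_of_mem_minimalPrimes_span (Set.toFinite _) hp
    refine (iInf₂_le (⟨p, hp.1.1⟩ : PrimeSpectrum (MvPolynomial (Fin 3) ℚ)) hp.1.2).trans ?_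
    rw [← PrimeSpectrum.height_eq_orderHeight]
    refine h1.trans ?_
    exact_mod_cast (Set.ncard_insert_le _ _).trans (by simp)
  · refine le_iInf₂ fun p hp => ?_
    have h2 := hp ex_g2
    have e : (X 1 ^ 2 - X 2 ^ 2 : MvPolynomial (Fin 3) ℚ) =
      (X 1 - C 1 * X 2) * (X 1 - C (-1) * X 2) := by simp; ring
    rw [e] at h2
    rcases p.2.mem_or_mem h2 with h | h
    · exact two_le_height p hp _ h
    · exact two_le_height p hp _ h

theorem example_lattice_ideal_Q3 :
    ∀ I : Ideal (MvPolynomial (Fin 3) ℚ),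
      I = Ideal.span {X 0 ^ 2 - X 1 * X 2, X 1 ^ 2 - X 2 ^ 2} →
      idealHeight I = 2 ∧
      (∀ i : Fin 3, zeroSet (I ⊔ Ideal.span {X i}) = {0}) ∧
      (∃ 𝓛 : AddSubgroup (Fin 3 → ℤ), I = latticeIdeal ℚ 𝓛) ∧
      ∀ (i : Fin 3) (f : MvPolynomial (Fin 3) ℚ), X i * f ∈ I → f ∈ I := by
  rintro I rfl
  exact ⟨height_ex, zeroSet_ex, ⟨exLattice, exIdeal_eq⟩, X_nzd⟩
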